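/- On ℝ⁴ with z = x₁+ix₂, w = x₃+ix₄, let f(x) = (p₁z² − 2p₂z w̄ + p₃w̄²)/(q₁w² + 2q₂z̄w + q₃z̄²) as in Example 5.2 with generic p,q ∈ ℂ³ (no relations assumed; denominator nonzero). Then the function x ↦ |x|²·Δ(|x|²·Δf)(x) vanishes identically if and only if the coefficients N₁ = p₁q₁q₃ − 4p₁q₂² + 6p₂q₁q₂ − 3p₃q₁², N₂ = 6p₁q₂q₃ − 8p₂q₁q₃ − 4p₂q₂² + 6p₃q₁q₂, N₃ = 3p₁q₃² − 6p₂q₂q₃ − p₃q₁q₃ + 4p₃q₂² all vanish. -/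

import Mathlib

open scoped BigOperators

/-- Partial derivative in the `i`-th coordinate direction. -/
noncomputable def pd (i : Fin 4) (f : EuclideanSpace ℝ (Fin 4) → ℂ)
    (x : EuclideanSpace ℝ (Fin 4)) : ℂ :=
  deriv (fun t : ℝ => f (x + t • EuclideanSpace.single i (1 : ℝ))) 0

/-- The classical Laplace operator `Δ` on `ℝ⁴`, acting on complex-valued functions. -/
noncomputable def lap (f : EuclideanSpace ℝ (Fin 4) → ℂ)
    (x : EuclideanSpace ℝ (Fin 4)) : ℂ :=
  ∑ i, pd i (pd i f) x

/-- `z = x₁ + i x₂`. -/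
noncomputable def zc (x : EuclideanSpace ℝ (Fin 4)) : ℂ := (x 0 : ℂ) + Complex.I * (x 1 : ℂ)

/-- `w = x₃ + i x₄`. -/
noncomputable def wc (x : EuclideanSpace ℝ (Fin 4)) : ℂ := (x 2 : ℂ) + Complex.I * (x 3 : ℂ)

/-- Numerator `P(x) = p₁(x₁+ix₂)² − 2p₂(x₁+ix₂)(x₃−ix₄) + p₃(x₃−ix₄)²`. -/
noncomputable def num (p : Fin 3 → ℂ) (x : EuclideanSpace ℝ (Fin 4)) : ℂ :=
  p 0 * (zc x) ^ 2 - 2 * p 1 * zc x * star (wc x) + p 2 * (star (wc x)) ^ 2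

/-- Denominator `Q(x) = q₁(x₃+ix₄)² + 2q₂(x₁−ix₂)(x₃+ix₄) + q₃(x₁−ix₂)²`. -/
noncomputable def den (q : Fin 3 → ℂ) (x : EuclideanSpace ℝ (Fin 4)) : ℂ :=
  q 0 * (wc x) ^ 2 + 2 * q 1 * star (zc x) * wc x + q 2 * (star (zc x)) ^ 2

open Filter Topology

/-- `g` has value `g₀`, first derivative `g₁` and second derivative `g₂` at `0`. -/
def HasTwoJet (g : ℝ → ℂ) (g₀ g₁ g₂ : ℂ) : Prop :=
  g 0 = g₀ ∧ ∃ g' : ℝ → ℂ, (∀ᶠ t in 𝓝 0, HasDerivAt g (g' t) t) ∧ g' 0 = g₁ ∧ HasDerivAt g' g₂ 0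

namespace HasTwoJet

variable {g h : ℝ → ℂ} {g₀ g₁ g₂ h₀ h₁ h₂ : ℂ}

theorem deriv_deriv (hg : HasTwoJet g g₀ g₁ g₂) : deriv (deriv g) 0 = g₂ := by
  obtain ⟨-, g', hd, -, hd'⟩ := hg
  have : deriv g =ᶠ[𝓝 0] g' := hd.mono fun t ht => ht.deriv
  rw [this.deriv_eq, hd'.deriv]

theorem continuousAt (hg : HasTwoJet g g₀ g₁ g₂) : ContinuousAt g 0 := by
  obtain ⟨-, g', hd, -, -⟩ := hg
  exact hd.self_of_nhds.continuousAt

theorem eventually_ne_zero (hg : HasTwoJet g g₀ g₁ g₂) (h0 : g₀ ≠ 0) : ∀ᶠ t in 𝓝 0, g t ≠ 0 :=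
  hg.continuousAt.eventually_ne (by rwa [hg.1])

theorem congr (hg : HasTwoJet g g₀ g₁ g₂) (hgh : h =ᶠ[𝓝 0] g) : HasTwoJet h g₀ g₁ g₂ := by
  obtain ⟨h0, g', hd, h1, hd'⟩ := hg
  refine ⟨by rw [hgh.self_of_nhds, h0], g', ?_, h1, hd'⟩
  filter_upwards [hd, hgh.eventually_nhds] with t ht hgt
  exact ht.congr_of_eventuallyEq hgt

theorem mul (hg : HasTwoJet g g₀ g₁ g₂) (hh : HasTwoJet h h₀ h₁ h₂) :
    HasTwoJet (fun t => g t * h t) (g₀ * h₀) (g₁ * h₀ + g₀ * h₁)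
      (g₂ * h₀ + 2 * g₁ * h₁ + g₀ * h₂) := by
  obtain ⟨rfl, g', hgd, rfl, hgd'⟩ := hg
  obtain ⟨rfl, h', hhd, rfl, hhd'⟩ := hh
  refine ⟨rfl, fun t => g' t * h t + g t * h' t, ?_, rfl, ?_⟩
  · filter_upwards [hgd, hhd] with t h1 h2 using h1.mul h2
  · refine ((hgd'.mul hhd.self_of_nhds).add (hgd.self_of_nhds.mul hhd')).congr_deriv ?_
    ring

theorem inv (hg : HasTwoJet g g₀ g₁ g₂) (h0 : g₀ ≠ 0) :
    HasTwoJet (fun t => (g t)⁻¹) g₀⁻¹ (-g₁ / g₀ ^ 2) (2 * g₁ ^ 2 / g₀ ^ 3 - g₂ / g₀ ^ 2) := by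
  have hne := hg.eventually_ne_zero h0
  obtain ⟨rfl, g', hgd, rfl, hgd'⟩ := hg
  refine ⟨rfl, fun t => -g' t / g t ^ 2, ?_, rfl, ?_⟩
  · filter_upwards [hgd, hne] with t h1 h2 using h1.inv h2
  · refine (hgd'.neg.div (hgd.self_of_nhds.pow 2) (pow_ne_zero 2 h0)).congr_deriv ?_
    simp only [Pi.neg_apply, Pi.pow_apply]
    field_simp
    ring

theorem quadratic (A B C : ℂ) :
    HasTwoJet (fun t : ℝ => A + B * t + C * (t : ℂ) ^ 2) A B (2 * C) := by
  have hid (t : ℝ) : HasDerivAt (fun t : ℝ => (t : ℂ)) 1 t := Complex.ofRealCLM.hasDerivAt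
  refine ⟨by simp, fun t => B + 2 * C * t, .of_forall fun t => ?_, by simp, ?_⟩
  · refine ((((hid t).const_mul B).const_add A).add (((hid t).pow 2).const_mul C)).congr_deriv ?_
    norm_num
    ring
  · exact (((hid 0).const_mul (2 * C)).const_add B).congr_deriv (by ring)

end HasTwoJet

theorem pd_pd_eq_deriv_deriv (i : Fin 4) (f : EuclideanSpace ℝ (Fin 4) → ℂ)
    (x : EuclideanSpace ℝ (Fin 4)) :
    pd i (pd i f) x
      = deriv (deriv fun t : ℝ => f (x + t • EuclideanSpace.single i (1 : ℝ))) 0 := by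
  unfold pd
  congr 1
  funext t
  have := deriv_comp_const_add (fun s : ℝ => f (x + s • EuclideanSpace.single i (1 : ℝ))) t 0
  rw [add_zero] at this
  rw [← this]
  simp only [add_smul, add_assoc]

theorem lap_eq_sum_of_hasTwoJet {f : EuclideanSpace ℝ (Fin 4) → ℂ} {x : EuclideanSpace ℝ (Fin 4)}
    {f₀ f₁ f₂ : Fin 4 → ℂ}
    (h : ∀ i, HasTwoJet (fun t : ℝ => f (x + t • EuclideanSpace.single i (1 : ℝ)))
      (f₀ i) (f₁ i) (f₂ i)) : lap f x = ∑ i, f₂ i :=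
  Finset.sum_congr rfl fun i _ => by rw [pd_pd_eq_deriv_deriv, (h i).deriv_deriv]

/-- The derivatives of `z` in the coordinate directions. -/
noncomputable def dz : Fin 4 → ℂ := ![1, Complex.I, 0, 0]
/-- The derivatives of `z̄` in the coordinate directions. -/
noncomputable def dzbar : Fin 4 → ℂ := ![1, -Complex.I, 0, 0]
/-- The derivatives of `w` in the coordinate directions. -/
noncomputable def dw : Fin 4 → ℂ := ![0, 0, 1, Complex.I]
/-- The derivatives of `w̄` in the coordinate directions. -/
noncomputable def dwbar : Fin 4 → ℂ := ![0, 0, 1, -Complex.I]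

section Line

variable (x : EuclideanSpace ℝ (Fin 4)) (i : Fin 4) (t : ℝ)

theorem zc_line : zc (x + t • EuclideanSpace.single i (1 : ℝ)) = zc x + dz i * t := by
  fin_cases i <;> simp [zc, dz] <;> ring

theorem wc_line : wc (x + t • EuclideanSpace.single i (1 : ℝ)) = wc x + dw i * t := by
  fin_cases i <;> simp [wc, dw] <;> ring

theorem star_zc_line :
    star (zc (x + t • EuclideanSpace.single i (1 : ℝ))) = star (zc x) + dzbar i * t := by
  rw [zc_line]
  fin_cases i <;> simp [dz, dzbar]

theorem star_wc_line :
    star (wc (x + t • EuclideanSpace.single i (1 : ℝ))) = star (wc x) + dwbar i * t := by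
  rw [wc_line]
  fin_cases i <;> simp [dw, dwbar]

end Line

theorem norm_sq_eq_zc_wc (x : EuclideanSpace ℝ (Fin 4)) :
    (‖x‖ : ℂ) ^ 2 = zc x * star (zc x) + wc x * star (wc x) := by
  have h : ‖x‖ ^ 2 = x 0 ^ 2 + x 1 ^ 2 + x 2 ^ 2 + x 3 ^ 2 := by
    simp [EuclideanSpace.real_norm_sq_eq, Fin.sum_univ_four]
  rw [← Complex.ofReal_pow, h]
  simp only [zc, wc, Complex.star_def, map_add, map_mul, Complex.conj_ofReal, Complex.conj_I]
  push_cast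
  linear_combination (-(x 1 : ℂ) ^ 2 - (x 3 : ℂ) ^ 2) * -Complex.I_sq

theorem hasTwoJet_num (p : Fin 3 → ℂ) (x : EuclideanSpace ℝ (Fin 4)) (i : Fin 4) :
    HasTwoJet (fun t : ℝ => num p (x + t • EuclideanSpace.single i (1 : ℝ))) (num p x)
      (2 * (p 0 * zc x * dz i - p 1 * (zc x * dwbar i + dz i * star (wc x))
        + p 2 * star (wc x) * dwbar i))
      (2 * (p 0 * dz i ^ 2 - 2 * p 1 * dz i * dwbar i + p 2 * dwbar i ^ 2)) := by
  refine (HasTwoJet.quadratic _ _ _).congr (.of_forall fun t => ?_)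
  simp only [num, zc_line, star_wc_line]
  ring

theorem hasTwoJet_den (q : Fin 3 → ℂ) (x : EuclideanSpace ℝ (Fin 4)) (i : Fin 4) :
    HasTwoJet (fun t : ℝ => den q (x + t • EuclideanSpace.single i (1 : ℝ))) (den q x)
      (2 * (q 0 * wc x * dw i + q 1 * (star (zc x) * dw i + dzbar i * wc x)
        + q 2 * star (zc x) * dzbar i))
      (2 * (q 0 * dw i ^ 2 + 2 * q 1 * dzbar i * dw i + q 2 * dzbar i ^ 2)) := by
  refine (HasTwoJet.quadratic _ _ _).congr (.of_forall fun t => ?_)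
  simp only [den, wc_line, star_zc_line]
  ring

/-- A quarter of the bilinear form `∂_z P ∂_z̄ Q + ∂_w̄ P ∂_w Q`. -/
noncomputable def pairing (p q : Fin 3 → ℂ) (x : EuclideanSpace ℝ (Fin 4)) : ℂ :=
  (p 0 * zc x - p 1 * star (wc x)) * (q 1 * wc x + q 2 * star (zc x))
    + (p 2 * star (wc x) - p 1 * zc x) * (q 0 * wc x + q 1 * star (zc x))

theorem hasTwoJet_pairing (p q : Fin 3 → ℂ) (x : EuclideanSpace ℝ (Fin 4)) (i : Fin 4) :
    HasTwoJet (fun t : ℝ => pairing p q (x + t • EuclideanSpace.single i (1 : ℝ))) (pairing p q x)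
      ((p 0 * dz i - p 1 * dwbar i) * (q 1 * wc x + q 2 * star (zc x))
        + (p 0 * zc x - p 1 * star (wc x)) * (q 1 * dw i + q 2 * dzbar i)
        + (p 2 * dwbar i - p 1 * dz i) * (q 0 * wc x + q 1 * star (zc x))
        + (p 2 * star (wc x) - p 1 * zc x) * (q 0 * dw i + q 1 * dzbar i))
      (2 * ((p 0 * dz i - p 1 * dwbar i) * (q 1 * dw i + q 2 * dzbar i)
        + (p 2 * dwbar i - p 1 * dz i) * (q 0 * dw i + q 1 * dzbar i))) := by
  refine (HasTwoJet.quadratic _ _ _).congr (.of_forall fun t => ?_)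
  simp only [pairing, star_zc_line, star_wc_line]
  simp only [zc_line, wc_line]
  ring

theorem hasTwoJet_norm_sq (x : EuclideanSpace ℝ (Fin 4)) (i : Fin 4) :
    HasTwoJet (fun t : ℝ => (‖x + t • EuclideanSpace.single i (1 : ℝ)‖ : ℂ) ^ 2)
      (zc x * star (zc x) + wc x * star (wc x))
      (zc x * dzbar i + dz i * star (zc x) + (wc x * dwbar i + dw i * star (wc x)))
      (2 * (dz i * dzbar i + dw i * dwbar i)) := by
  refine (HasTwoJet.quadratic _ _ _).congr (.of_forall fun t => ?_)
  simp only [norm_sq_eq_zc_wc, star_zc_line, star_wc_line]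
  simp only [zc_line, wc_line]
  ring

theorem lap_num_div_den (p q : Fin 3 → ℂ) {x : EuclideanSpace ℝ (Fin 4)} (hx : den q x ≠ 0) :
    lap (fun v => num p v / den q v) x = -16 * pairing p q x * ((den q x)⁻¹ * (den q x)⁻¹) := by
  simp only [div_eq_mul_inv]
  rw [lap_eq_sum_of_hasTwoJet fun i => (hasTwoJet_num p x i).mul ((hasTwoJet_den q x i).inv hx)]
  simp only [Fin.sum_univ_four, dz, dzbar, dw, dwbar, Matrix.cons_val]
  unfold pairing
  field_simp
  ring_nf
  simp only [Complex.I_sq]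
  ring

/-- The quadratic form `-N₁ w² + N₂ z̄ w + N₃ z̄²`. -/
def biharmonicForm (p q : Fin 3 → ℂ) (b c : ℂ) : ℂ :=
  -(p 0 * q 0 * q 2 - 4 * p 0 * (q 1) ^ 2 + 6 * p 1 * q 0 * q 1 - 3 * p 2 * (q 0) ^ 2) * c ^ 2
    + (6 * p 0 * q 1 * q 2 - 8 * p 1 * q 0 * q 2 - 4 * p 1 * (q 1) ^ 2
        + 6 * p 2 * q 0 * q 1) * (b * c)
    + (3 * p 0 * (q 2) ^ 2 - 6 * p 1 * q 1 * q 2 - p 2 * q 0 * q 2 + 4 * p 2 * (q 1) ^ 2) * b ^ 2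

set_option maxRecDepth 10000 in
theorem lap_norm_sq_mul_lap (p q : Fin 3 → ℂ) {x : EuclideanSpace ℝ (Fin 4)} (hx : den q x ≠ 0) :
    lap (fun y => (‖y‖ : ℂ) ^ 2 * lap (fun v => num p v / den q v) y) x
      = 64 * (‖x‖ : ℂ) ^ 2 * biharmonicForm p q (star (zc x)) (wc x) / den q x ^ 3 := by
  have key (i : Fin 4) :=
    (((hasTwoJet_norm_sq x i).mul (((HasTwoJet.quadratic (-16) 0 0).mul
      (hasTwoJet_pairing p q x i)).mul
      (((hasTwoJet_den q x i).inv hx).mul ((hasTwoJet_den q x i).inv hx))))).congr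
      (h := fun t : ℝ => (fun y => (‖y‖ : ℂ) ^ 2 * lap (fun v => num p v / den q v) y)
        (x + t • EuclideanSpace.single i (1 : ℝ)))
      (by
        filter_upwards [(hasTwoJet_den q x i).eventually_ne_zero hx] with t ht
        simp [lap_num_div_den p q ht])
  rw [lap_eq_sum_of_hasTwoJet key, norm_sq_eq_zc_wc]
  simp only [Fin.sum_univ_four, dz, dzbar, dw, dwbar, Matrix.cons_val]
  obtain ⟨Q, hQ⟩ : ∃ Q, Q = den q x := ⟨_, rfl⟩
  rw [← hQ] at hx ⊢
  unfold pairing biharmonicForm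
  unfold den at hQ
  generalize star (zc x) = b at *
  generalize star (wc x) = d at *
  generalize zc x = a at *
  generalize wc x = c at *
  clear key
  field_simp
  subst hQ
  ring_nf
  simp only [Complex.I_sq]
  ring

theorem exists_zc_wc_eq (b c : ℂ) :
    ∃ x : EuclideanSpace ℝ (Fin 4), star (zc x) = b ∧ wc x = c := by
  refine ⟨!₂[b.re, -b.im, c.re, c.im], ?_, ?_⟩ <;>
    apply Complex.ext <;> simp [zc, wc]

open Polynomial in
/-- A quadratic form on `ℂ` vanishing wherever a given nonzero one does not is zero. -/
theorem quadratic_coeff_eq_zero {a₀ a₁ a₂ b₀ b₁ b₂ : ℂ} (ha : ¬(a₀ = 0 ∧ a₁ = 0 ∧ a₂ = 0))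
    (h : ∀ t : ℂ, a₀ * t ^ 2 + a₁ * t + a₂ ≠ 0 → b₀ * t ^ 2 + b₁ * t + b₂ = 0) :
    b₀ = 0 ∧ b₁ = 0 ∧ b₂ = 0 := by
  have coeffs {c₀ c₁ c₂ : ℂ} (hc : C c₀ * X ^ 2 + C c₁ * X + C c₂ = 0) :
      c₀ = 0 ∧ c₁ = 0 ∧ c₂ = 0 := by
    have h2 := congrArg (coeff · 2) hc
    have h1 := congrArg (coeff · 1) hc
    have h0 := congrArg (coeff · 0) hc
    simp [coeff_X, coeff_C] at h0 h1 h2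
    exact ⟨h2, h1, h0⟩
  have hmul : (C a₀ * X ^ 2 + C a₁ * X + C a₂) * (C b₀ * X ^ 2 + C b₁ * X + C b₂) = 0 := by
    refine Polynomial.funext fun t => ?_
    simpa [or_iff_not_imp_left] using h t
  exact coeffs ((mul_eq_zero.mp hmul).resolve_left fun h0 => ha (coeffs h0))

/-- for generic `p,q ∈ ℂ³` (`q ≠ 0`), the bitension field
`x ↦ |x|²Δ(|x|²Δf)(x)` of `f = P/Q` vanishes identically on the open dense set where
the denominator is nonzero if and only if `N₁ = N₂ = N₃ = 0`, where
`N₁ = p₁q₁q₃ − 4p₁q₂² + 6p₂q₁q₂ − 3p₃q₁²`,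
`N₂ = 6p₁q₂q₃ − 8p₂q₁q₃ − 4p₂q₂² + 6p₃q₁q₂`,
`N₃ = 3p₁q₃² − 6p₂q₂q₃ − p₃q₁q₃ + 4p₃q₂²`. -/
theorem stmt_15 (p q : Fin 3 → ℂ) (hq : q ≠ 0) :
    (∀ x : EuclideanSpace ℝ (Fin 4), den q x ≠ 0 →
      (‖x‖ : ℂ) ^ 2
        * lap (fun y => (‖y‖ : ℂ) ^ 2 * lap (fun v => num p v / den q v) y) x = 0)
    ↔ (p 0 * q 0 * q 2 - 4 * p 0 * (q 1) ^ 2 + 6 * p 1 * q 0 * q 1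
          - 3 * p 2 * (q 0) ^ 2 = 0
        ∧ 6 * p 0 * q 1 * q 2 - 8 * p 1 * q 0 * q 2 - 4 * p 1 * (q 1) ^ 2
          + 6 * p 2 * q 0 * q 1 = 0
        ∧ 3 * p 0 * (q 2) ^ 2 - 6 * p 1 * q 1 * q 2 - p 2 * q 0 * q 2
          + 4 * p 2 * (q 1) ^ 2 = 0) := by
  constructor
  · intro h
    have hq' : ¬(q 0 = 0 ∧ 2 * q 1 = 0 ∧ q 2 = 0) := by
      rintro ⟨h0, h1, h2⟩
      refine hq (funext fun i => ?_)
      fin_cases i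
      exacts [h0, by simpa using h1, h2]
    have hform (t : ℂ) (ht : q 0 * t ^ 2 + 2 * q 1 * t + q 2 ≠ 0) : biharmonicForm p q 1 t = 0 := by
      obtain ⟨x, hb, hc⟩ := exists_zc_wc_eq 1 t
      have hx : den q x ≠ 0 := by simpa [den, hb, hc] using ht
      have hnorm : (‖x‖ : ℂ) ≠ 0 := by
        rw [Complex.ofReal_ne_zero, norm_ne_zero_iff]
        rintro rfl
        simp [den, zc, wc] at hx
      have := h x hx
      rw [lap_norm_sq_mul_lap p q hx, hb, hc] at this
      simpa [hnorm, hx] using this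
    obtain ⟨h0, h1, h2⟩ := quadratic_coeff_eq_zero hq'
      fun t ht => (by linear_combination (norm := (unfold biharmonicForm; ring)) hform t ht :
        -(p 0 * q 0 * q 2 - 4 * p 0 * (q 1) ^ 2 + 6 * p 1 * q 0 * q 1
          - 3 * p 2 * (q 0) ^ 2) * t ^ 2
        + (6 * p 0 * q 1 * q 2 - 8 * p 1 * q 0 * q 2 - 4 * p 1 * (q 1) ^ 2
          + 6 * p 2 * q 0 * q 1) * t
        + (3 * p 0 * (q 2) ^ 2 - 6 * p 1 * q 1 * q 2 - p 2 * q 0 * q 2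
          + 4 * p 2 * (q 1) ^ 2) = 0)
    exact ⟨neg_eq_zero.mp h0, h1, h2⟩
  · rintro ⟨h1, h2, h3⟩ x hx
    rw [lap_norm_sq_mul_lap p q hx, biharmonicForm, h1, h2, h3]
    simp
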